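/- Let X, Y, Z be finite nonempty types with |X| · |Y| · |Z| ≥ 2, and let p, q be probability mass functions on X × Y × Z. If the L1 distance d = ∑ (x,y,z), |p (x,y,z) − q (x,y,z)| satisfies 0 < d ≤ 1/2, then |I_p(X;Y|Z) − I_q(X;Y|Z)| ≤ 4 * d * Real.log (|X| · |Y| · |Z| / d). -/

import Mathlib

/-- The conditional mutual information `I_p(X;Y|Z) = H(p_XZ) + H(p_YZ) − H(p_Z) − H(p)`
of a joint distribution `p` on `X × Y × Z`, with entropy in nats. -/
noncomputable def condMutualInfo {X Y Z : Type*} [Fintype X] [Fintype Y] [Fintype Z]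
    (p : X × Y × Z → ℝ) : ℝ :=
  (∑ x, ∑ z, Real.negMulLog (∑ y, p (x, y, z))) +
    (∑ y, ∑ z, Real.negMulLog (∑ x, p (x, y, z))) -
    (∑ z, Real.negMulLog (∑ x, ∑ y, p (x, y, z))) -
    (∑ g, Real.negMulLog (p g))

open Real in
lemma aux_half {r : ℝ} (h0 : 0 ≤ r) (h1 : r ≤ 1 / 2) : negMulLog (1 - r) ≤ negMulLog r := by
  have hder : ∀ x ∈ Set.Ioo (0 : ℝ) (1/2),
      HasDerivAt (fun x => negMulLog x - negMulLog (1 - x)) (-log (x * (1 - x)) - 2) x := by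
    intro x hx
    have hx0 : x ≠ 0 := hx.1.ne'
    have hx1 : 1 - x ≠ 0 := by have := hx.2; intro h; linarith
    have h2 : HasDerivAt (fun x : ℝ => 1 - x) (-1) x := by
      simpa using (hasDerivAt_id x).const_sub 1
    have h3 := (hasDerivAt_negMulLog hx0).sub ((hasDerivAt_negMulLog hx1).comp x h2)
    refine h3.congr_deriv ?_
    rw [log_mul hx0 hx1]; ring
  have hc : ConcaveOn ℝ (Set.Icc (0 : ℝ) (1/2)) (fun x => negMulLog x - negMulLog (1 - x)) := by
    apply AntitoneOn.concaveOn_of_deriv (convex_Icc _ _)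
    · fun_prop
    · rw [interior_Icc]
      intro x hx
      exact (hder x hx).differentiableAt.differentiableWithinAt
    · rw [interior_Icc]
      intro x hx y hy hxy
      rw [(hder x hx).deriv, (hder y hy).deriv]
      have : log (x * (1 - x)) ≤ log (y * (1 - y)) := by
        apply log_le_log
        · have := hx.1; have := hx.2; apply mul_pos <;> linarith
        · have := hx.2; have := hy.2
          nlinarith
      linarith
  have := hc.2 (show (0 : ℝ) ∈ Set.Icc (0 : ℝ) (1/2) by constructor <;> norm_num)
    (show (1/2 : ℝ) ∈ Set.Icc (0 : ℝ) (1/2) by constructor <;> norm_num)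
    (show 0 ≤ 1 - 2 * r by linarith) (show 0 ≤ 2 * r by linarith) (by ring)
  have e : (1 : ℝ) - 1/2 = 1/2 := by norm_num
  simp only [smul_eq_mul, mul_zero, zero_add, negMulLog_zero, sub_zero, negMulLog_one, e,
    sub_self] at this
  have e2 : 2 * r * (1 / 2) = r := by ring
  rw [e2] at this
  linarith

open Real in
lemma aux_point' {s t : ℝ} (h0 : 0 ≤ s) (hst : s ≤ t) (h1 : t ≤ 1) (hr : t - s ≤ 1 / 2) :
    |negMulLog t - negMulLog s| ≤ negMulLog (t - s) := by
  rcases hst.eq_or_lt with rfl | hlt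
  · simp
  rw [abs_le]
  constructor
  · have hs : 0 < 1 - s := by linarith
    have hc := concaveOn_negMulLog
    have ha : 0 ≤ (1 - t) / (1 - s) := div_nonneg (by linarith) hs.le
    have hb : 0 ≤ (t - s) / (1 - s) := div_nonneg (by linarith) hs.le
    have hab : (1 - t) / (1 - s) + (t - s) / (1 - s) = 1 := by field_simp; ring
    have i1 := hc.2 (show s ∈ Set.Ici (0 : ℝ) from h0) (show (1 : ℝ) ∈ Set.Ici (0 : ℝ) by simp) ha hb hab
    have i2 := hc.2 (show s ∈ Set.Ici (0 : ℝ) from h0) (show (1 : ℝ) ∈ Set.Ici (0 : ℝ) by simp) hb ha (by rw [add_comm]; exact hab)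
    have e1 : ((1 - t) / (1 - s)) • s + ((t - s) / (1 - s)) • (1 : ℝ) = t := by
      simp only [smul_eq_mul]; field_simp; ring
    have e2 : ((t - s) / (1 - s)) • s + ((1 - t) / (1 - s)) • (1 : ℝ) = 1 - (t - s) := by
      simp only [smul_eq_mul]; field_simp; ring
    rw [e1] at i1
    rw [e2] at i2
    simp only [smul_eq_mul, negMulLog_one, mul_zero, add_zero] at i1 i2
    have i3 := aux_half (r := t - s) (by linarith) hr
    have i4 : (1 - t) / (1 - s) * negMulLog s + (t - s) / (1 - s) * negMulLog s
        = negMulLog s := by rw [← add_mul, hab, one_mul]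
    linarith
  · have k1 : s * log s ≤ s * log t := by
      rcases h0.eq_or_lt with rfl | hs
      · simp
      · exact mul_le_mul_of_nonneg_left (log_le_log hs hst) h0
    have k2 : (t - s) * log (t - s) ≤ (t - s) * log t :=
      mul_le_mul_of_nonneg_left (log_le_log (by linarith) (by linarith)) (by linarith)
    simp only [negMulLog]
    nlinarith

open Real in
lemma aux_point {s t : ℝ} (h0 : 0 ≤ s) (h0' : 0 ≤ t) (h1 : s ≤ 1) (h1' : t ≤ 1)
    (hr : |s - t| ≤ 1 / 2) :
    |negMulLog s - negMulLog t| ≤ negMulLog |s - t| := by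
  rcases le_total s t with h | h
  · rw [abs_sub_comm s t, abs_of_nonneg (sub_nonneg.2 h)] at *
    rw [abs_sub_comm]
    exact aux_point' h0 h h1' hr
  · rw [abs_of_nonneg (sub_nonneg.2 h)] at *
    exact aux_point' h0' h h1 hr

open Real in
lemma aux_tangent {e c : ℝ} (he : 0 ≤ e) (hc : 0 < c) :
    negMulLog e ≤ e * (-log c) + c - e := by
  rcases he.eq_or_lt with rfl | he
  · simp [hc.le]
  have h := log_le_sub_one_of_pos (div_pos hc he)
  rw [log_div hc.ne' he.ne'] at h
  have h2 := mul_le_mul_of_nonneg_left h he.le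
  have h3 : e * (c / e - 1) = c - e := by field_simp
  rw [h3] at h2
  simp only [negMulLog]
  linarith

open Real in
lemma aux_entropy {I : Type*} [Fintype I] (a b : I → ℝ) (ha : ∀ i, 0 ≤ a i) (hb : ∀ i, 0 ≤ b i)
    (ha1 : ∑ i, a i = 1) (hb1 : ∑ i, b i = 1) {d N : ℝ} (hd0 : 0 < d) (hd : d ≤ 1 / 2)
    (hN : 2 ≤ N) (hI : (Fintype.card I : ℝ) ≤ N) (hab : ∑ i, |a i - b i| ≤ d) :
    |∑ i, negMulLog (a i) - ∑ i, negMulLog (b i)| ≤ d * log (N / d) := by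
  have hN0 : 0 < N := by linarith
  have hc : 0 < d / N := div_pos hd0 hN0
  have hlog : 1 ≤ log (N / d) := by
    rw [le_log_iff_exp_le (div_pos hN0 hd0), le_div_iff₀ hd0]
    have := exp_one_lt_d9
    nlinarith
  have hlc : -log (d / N) = log (N / d) := by rw [← log_inv, inv_div]
  have step : ∀ i, |negMulLog (a i) - negMulLog (b i)| ≤
      |a i - b i| * log (N / d) + d / N - |a i - b i| := by
    intro i
    have l1 : a i ≤ 1 := ha1 ▸ Finset.single_le_sum (fun j _ => ha j) (Finset.mem_univ i)
    have l2 : b i ≤ 1 := hb1 ▸ Finset.single_le_sum (fun j _ => hb j) (Finset.mem_univ i)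
    have l3 : |a i - b i| ≤ ∑ i, |a i - b i| :=
      Finset.single_le_sum (f := fun i => |a i - b i|) (fun j _ => abs_nonneg _)
        (Finset.mem_univ i)
    have := aux_tangent (abs_nonneg (a i - b i)) hc
    rw [hlc] at this
    exact (aux_point (ha i) (hb i) l1 l2 (by linarith)).trans this
  rw [← Finset.sum_sub_distrib]
  refine (Finset.abs_sum_le_sum_abs _ _).trans ((Finset.sum_le_sum fun i _ => step i).trans ?_)
  rw [Finset.sum_sub_distrib, Finset.sum_add_distrib, ← Finset.sum_mul]
  simp only [Finset.sum_const, Finset.card_univ, nsmul_eq_mul]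
  have h5 : (Fintype.card I : ℝ) * (d / N) ≤ d := by
    rw [mul_div_assoc', div_le_iff₀ hN0]; nlinarith
  nlinarith

lemma aux_marg {G I : Type*} [Fintype G] [Fintype I] [DecidableEq I] (f : G → I) (p q : G → ℝ) :
    ∑ i, |∑ g with f g = i, p g - ∑ g with f g = i, q g| ≤ ∑ g, |p g - q g| := by
  rw [← Finset.sum_fiberwise Finset.univ f (fun g => |p g - q g|)]
  refine Finset.sum_le_sum fun i _ => ?_
  rw [← Finset.sum_sub_distrib]
  exact Finset.abs_sum_le_sum_abs _ _

open Real in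
lemma aux_marg_entropy {G I : Type*} [Fintype G] [Fintype I] (f : G → I)
    (hf : Function.Surjective f) (p q : G → ℝ)
    (hp0 : ∀ g, 0 ≤ p g) (hp1 : ∑ g, p g = 1)
    (hq0 : ∀ g, 0 ≤ q g) (hq1 : ∑ g, q g = 1)
    (hd0 : 0 < ∑ g, |p g - q g|) (hdhalf : (∑ g, |p g - q g|) ≤ 1 / 2)
    (hN : 2 ≤ (Fintype.card G : ℝ)) (mp mq : I → ℝ)
    (hmp : ∀ F : I → ℝ, ∑ i, F i * mp i = ∑ g, F (f g) * p g)
    (hmq : ∀ F : I → ℝ, ∑ i, F i * mq i = ∑ g, F (f g) * q g) :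
    |∑ i, negMulLog (mp i) - ∑ i, negMulLog (mq i)| ≤
      (∑ g, |p g - q g|) * log (Fintype.card G / ∑ g, |p g - q g|) := by
  classical
  have e1 : ∀ i, mp i = ∑ g with f g = i, p g := by
    intro i
    have := hmp (fun j => if j = i then 1 else 0)
    simpa [Finset.sum_filter] using this
  have e2 : ∀ i, mq i = ∑ g with f g = i, q g := by
    intro i
    have := hmq (fun j => if j = i then 1 else 0)
    simpa [Finset.sum_filter] using this
  apply aux_entropy mp mq
  · intro i; rw [e1]; exact Finset.sum_nonneg fun g _ => hp0 g
  · intro i; rw [e2]; exact Finset.sum_nonneg fun g _ => hq0 g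
  · simpa [hp1] using hmp 1
  · simpa [hq1] using hmq 1
  · exact hd0
  · exact hdhalf
  · exact hN
  · exact_mod_cast Fintype.card_le_of_surjective f hf
  · simp only [e1, e2]
    exact aux_marg f p q

/-- For pmfs `p, q` on `X × Y × Z` with `|X|·|Y|·|Z| ≥ 2`, if the L1 distance
`d = ∑ g, |p g − q g|` satisfies `0 < d ≤ 1/2`, then
`|I_p(X;Y|Z) − I_q(X;Y|Z)| ≤ 4 d log(|X|·|Y|·|Z| / d)`. -/
theorem condMutualInfo_continuity {X Y Z : Type*} [Fintype X] [Fintype Y] [Fintype Z]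
    [Nonempty X] [Nonempty Y] [Nonempty Z]
    (hcard : 2 ≤ Fintype.card X * Fintype.card Y * Fintype.card Z)
    (p q : X × Y × Z → ℝ)
    (hp0 : ∀ g, 0 ≤ p g) (hp1 : ∑ g, p g = 1)
    (hq0 : ∀ g, 0 ≤ q g) (hq1 : ∑ g, q g = 1)
    (hd0 : 0 < ∑ g, |p g - q g|) (hdhalf : (∑ g, |p g - q g|) ≤ 1 / 2) :
    |condMutualInfo p - condMutualInfo q| ≤
      4 * (∑ g, |p g - q g|) *
        Real.log ((Fintype.card X * Fintype.card Y * Fintype.card Z : ℝ) /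
          (∑ g, |p g - q g|)) := by
  have hcg : (Fintype.card (X × Y × Z) : ℝ)
      = (Fintype.card X * Fintype.card Y * Fintype.card Z : ℝ) := by
    simp [Fintype.card_prod, mul_assoc]
  have hN : 2 ≤ (Fintype.card (X × Y × Z) : ℝ) := by
    rw [hcg]; exact_mod_cast hcard
  have hXZ : ∀ (r : X × Y × Z → ℝ) (F : X × Z → ℝ),
      ∑ i, F i * (∑ y, r (i.1, y, i.2)) = ∑ g, F (g.1, g.2.2) * r g := by
    intro r F
    simp only [Fintype.sum_prod_type, Finset.mul_sum]
    exact Finset.sum_congr rfl fun x _ => Finset.sum_comm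
  have hYZ : ∀ (r : X × Y × Z → ℝ) (F : Y × Z → ℝ),
      ∑ i, F i * (∑ x, r (x, i.1, i.2)) = ∑ g, F (g.2.1, g.2.2) * r g := by
    intro r F
    simp only [Finset.mul_sum]
    rw [Finset.sum_comm]
    simp only [Fintype.sum_prod_type]
  have hZ : ∀ (r : X × Y × Z → ℝ) (F : Z → ℝ),
      ∑ i, F i * (∑ x, ∑ y, r (x, y, i)) = ∑ g, F g.2.2 * r g := by
    intro r F
    simp only [Fintype.sum_prod_type, Finset.mul_sum]
    rw [Finset.sum_comm]
    exact Finset.sum_congr rfl fun x _ => Finset.sum_comm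
  have A := aux_marg_entropy (fun g : X × Y × Z => (g.1, g.2.2))
    (fun i => ⟨(i.1, Classical.arbitrary Y, i.2), rfl⟩)
    p q hp0 hp1 hq0 hq1 hd0 hdhalf hN _ _ (hXZ p) (hXZ q)
  have B := aux_marg_entropy (fun g : X × Y × Z => (g.2.1, g.2.2))
    (fun i => ⟨(Classical.arbitrary X, i.1, i.2), rfl⟩)
    p q hp0 hp1 hq0 hq1 hd0 hdhalf hN _ _ (hYZ p) (hYZ q)
  have C := aux_marg_entropy (fun g : X × Y × Z => g.2.2)
    (fun i => ⟨(Classical.arbitrary X, Classical.arbitrary Y, i), rfl⟩)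
    p q hp0 hp1 hq0 hq1 hd0 hdhalf hN _ _ (hZ p) (hZ q)
  have D := aux_entropy p q hp0 hq0 hp1 hq1 hd0 hdhalf hN le_rfl le_rfl
  rw [Fintype.sum_prod_type, Fintype.sum_prod_type] at A B
  rw [hcg] at A B C D
  unfold condMutualInfo
  rw [mul_assoc]
  rw [abs_le] at *
  constructor <;> linarith [A.1, A.2, B.1, B.2, C.1, C.2, D.1, D.2]
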